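/- Rank of the canonical divisor: For every graph G of genus g with canonical divisor K, one has r(K) = g − 1. -/

import Mathlib

open Finset

variable {V : Type}

/-- Degree of a vertex in the multigraph with edge multiplicities `m`. -/
def mdeg [Fintype V] (m : V → V → ℕ) (v : V) : ℕ := ∑ w, m v w

/-- The Laplacian of an integer-valued function on the vertices. -/
def laplacian [Fintype V] (m : V → V → ℕ) (f : V → ℤ) : V → ℤ :=
  fun v => (mdeg m v : ℤ) * f v - ∑ w, (m v w : ℤ) * f w

/-- Linear equivalence of divisors. -/
def LinEquiv [Fintype V] (m : V → V → ℕ) (D D' : V → ℤ) : Prop :=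
  ∃ f : V → ℤ, D - D' = laplacian m f

/-- A divisor is effective if it is nonnegative everywhere. -/
def Effective (D : V → ℤ) : Prop := ∀ v, 0 ≤ D v

/-- Degree of a divisor. -/
def divDeg [Fintype V] (D : V → ℤ) : ℤ := ∑ v, D v

/-- `D` is linearly equivalent to some effective divisor. -/
def Winnable [Fintype V] (m : V → V → ℕ) (D : V → ℤ) : Prop :=
  ∃ E, Effective E ∧ LinEquiv m D E

/-- Number of edges of the multigraph. -/
def edgeCount [Fintype V] (m : V → V → ℕ) : ℤ := (∑ v, ∑ w, (m v w : ℤ)) / 2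

/-- The genus `g = |E| - |V| + 1`. -/
def genus [Fintype V] (m : V → V → ℕ) : ℤ := edgeCount m - Fintype.card V + 1

/-- `m` describes a graph: symmetric, loopless, and connected. -/
def IsGraph [Fintype V] (m : V → V → ℕ) : Prop :=
  (∀ v w, m v w = m w v) ∧ (∀ v, m v v = 0) ∧
  (SimpleGraph.fromRel (fun v w => 0 < m v w)).Connected

/-- The rank `r(D)` of the linear system of a divisor. -/
noncomputable def rankDiv [Fintype V] (m : V → V → ℕ) (D : V → ℤ) : ℤ :=
  sSup {s : ℤ | s = -1 ∨ (0 ≤ s ∧ ∀ E : V → ℤ, Effective E → divDeg E = s →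
    Winnable m (D - E))}

/-- The canonical divisor `K`. -/
def canonical [Fintype V] (m : V → V → ℕ) : V → ℤ := fun v => (mdeg m v : ℤ) - 2

lemma lap_eq [Fintype V] (m : V → V → ℕ) (f : V → ℤ) (v : V) :
    laplacian m f v = ∑ w, (m v w : ℤ) * (f v - f w) := by
  simp only [laplacian, mdeg, mul_sub, Finset.sum_sub_distrib]
  push_cast
  rw [Finset.sum_mul]

lemma lap_add [Fintype V] (m : V → V → ℕ) (f g : V → ℤ) :
    laplacian m (f + g) = laplacian m f + laplacian m g := by
  funext v
  simp only [lap_eq, Pi.add_apply, ← Finset.sum_add_distrib]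
  exact Finset.sum_congr rfl fun w _ => by ring

lemma lap_neg [Fintype V] (m : V → V → ℕ) (f : V → ℤ) :
    laplacian m (-f) = - laplacian m f := by
  funext v
  simp only [lap_eq, Pi.neg_apply, ← Finset.sum_neg_distrib]
  exact Finset.sum_congr rfl fun w _ => by ring

lemma lap_sum [Fintype V] (m : V → V → ℕ) (hs : ∀ v w, m v w = m w v) (f : V → ℤ) :
    ∑ v, laplacian m f v = 0 := by
  have h1 : ∑ v, laplacian m f v = ∑ v, ∑ w, (m v w : ℤ) * (f v - f w) :=
    Finset.sum_congr rfl fun v _ => lap_eq m f v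
  have h2 : ∑ v, ∑ w, (m v w : ℤ) * (f v - f w) = - ∑ v, ∑ w, (m v w : ℤ) * (f v - f w) := by
    conv_lhs => rw [Finset.sum_comm]
    simp only [← Finset.sum_neg_distrib]
    refine Finset.sum_congr rfl fun v _ => Finset.sum_congr rfl fun w _ => ?_
    rw [hs w v]; ring
  omega

lemma conn_closed [Fintype V] (m : V → V → ℕ) (hm : IsGraph m) (S : Set V)
    (hS : ∀ v ∈ S, ∀ w, 0 < m v w → w ∈ S) (a : V) (ha : a ∈ S) (b : V) : b ∈ S := by
  obtain ⟨p⟩ := hm.2.2.preconnected a b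
  induction p with
  | nil => exact ha
  | cons h p ih =>
    apply ih
    rw [SimpleGraph.fromRel_adj] at h
    rcases h.2 with h | h
    · exact hS _ ha _ h
    · exact hS _ ha _ (by rw [hm.1]; exact h)

lemma lap_ker [Fintype V] (m : V → V → ℕ) (hm : IsGraph m) (f : V → ℤ)
    (hf : laplacian m f = 0) (a b : V) : f a = f b := by
  obtain ⟨v, -, hv⟩ := Finset.exists_max_image Finset.univ f ⟨a, Finset.mem_univ a⟩
  have key : ∀ c, c ∈ {u | f u = f v} := by
    refine conn_closed m hm {u | f u = f v} ?_ v rfl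
    intro u hu w hw
    have hu' : f u = f v := hu
    have h0 : ∑ w, (m u w : ℤ) * (f u - f w) = 0 := by
      rw [← lap_eq, hf]; rfl
    rw [Finset.sum_eq_zero_iff_of_nonneg] at h0
    · have := h0 w (Finset.mem_univ w)
      rcases mul_eq_zero.1 this with h | h
      · omega
      · show f w = f v
        omega
    · intro x hx
      have := hv x hx
      exact mul_nonneg (by positivity) (by omega)
  exact (key a).trans (key b).symm

/-- divisor of an ordering -/
def nu [Fintype V] (m : V → V → ℕ) (o : V → ℤ) : V → ℤ :=
  fun v => ∑ w, (if o w < o v then (m v w : ℤ) else 0) - 1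

lemma nu_not_win [Fintype V] [Nonempty V] (m : V → V → ℕ) (o : V → ℤ) (D : V → ℤ)
    (hD : ∀ v, D v ≤ nu m o v) : ¬ Winnable m D := by
  rintro ⟨E, hE, f, hf⟩
  obtain ⟨u, -, hu⟩ := Finset.exists_max_image (Finset.univ : Finset V) f Finset.univ_nonempty
  obtain ⟨v, hv, hvo⟩ := Finset.exists_min_image (Finset.univ.filter fun x => f x = f u) o
    ⟨u, by simp⟩
  have hv' : f v = f u := by simpa using hv
  have h1 := congrFun hf v
  rw [lap_eq] at h1
  have h2 : ∑ w, (if o w < o v then (m v w : ℤ) else 0) ≤ ∑ w, (m v w : ℤ) * (f v - f w) := by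
    apply Finset.sum_le_sum
    intro w hw
    have h3 := hu w hw
    split_ifs with h
    · have h4 : f w ≠ f u := by
        intro h4
        have := hvo w (by simp [h4])
        omega
      have h5 : 1 ≤ f v - f w := by omega
      nlinarith [Int.natCast_nonneg (m v w)]
    · exact mul_nonneg (by positivity) (by omega)
  have h6 := hD v
  have h7 := hE v
  simp only [nu, Pi.sub_apply] at h6 h1
  omega

lemma nu_add [Fintype V] (m : V → V → ℕ) (hm : IsGraph m) (o : V → ℤ)
    (ho : Function.Injective o) (v : V) :
    nu m o v + nu m (fun x => - o x) v = canonical m v := by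
  have : ∑ w, (if o w < o v then (m v w : ℤ) else 0)
      + ∑ w, (if - o w < - o v then (m v w : ℤ) else 0) = ∑ w, (m v w : ℤ) := by
    rw [← Finset.sum_add_distrib]
    refine Finset.sum_congr rfl fun w _ => ?_
    by_cases h : w = v
    · subst h; simp [hm.2.1]
    · have := ho.ne h
      split_ifs <;> omega
  simp only [nu, canonical, mdeg]
  push_cast
  omega

lemma nu_sum [Fintype V] (m : V → V → ℕ) (hm : IsGraph m) (o : V → ℤ)
    (ho : Function.Injective o) : ∑ v, nu m o v = genus m - 1 := by
  have h1 : ∑ v, nu m o v + ∑ v, nu m (fun x => - o x) v = ∑ v, ∑ w, (m v w : ℤ)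
      - 2 * Fintype.card V := by
    rw [← Finset.sum_add_distrib, Finset.sum_congr rfl fun v _ => nu_add m hm o ho v]
    show ∑ v, ((mdeg m v : ℤ) - 2) = _
    simp only [mdeg, Finset.sum_sub_distrib]
    simp [mul_comm]
  have h2 : ∑ v, nu m o v = ∑ v, nu m (fun x => - o x) v := by
    simp only [nu, Finset.sum_sub_distrib]
    congr 1
    rw [Finset.sum_comm]
    refine Finset.sum_congr rfl fun v _ => Finset.sum_congr rfl fun w _ => ?_
    simp only [neg_lt_neg_iff]
    rw [hm.1 w v]
  unfold genus edgeCount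
  omega

open Classical in
lemma dhar_aux [Fintype V] (m : V → V → ℕ) (D : V → ℤ)
    (hP : ∀ S : Finset V, S.Nonempty → ∃ v ∈ S, D v + 1 ≤ ∑ w, if w ∉ S then (m v w : ℤ) else 0)
    (n : ℕ) : ∀ S : Finset V, S.card = n → ∃ o : V → ℤ, (∀ v, 0 ≤ o v) ∧ Set.InjOn o S ∧
      ∀ v ∈ S, D v + 1 ≤ ∑ w, if (w ∉ S ∨ o w < o v) then (m v w : ℤ) else 0 := by
  induction n with
  | zero =>
    intro S hS
    rw [Finset.card_eq_zero] at hS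
    subst hS
    exact ⟨fun _ => 0, by simp, by simp, by simp⟩
  | succ n ih =>
    intro S hS
    obtain ⟨v, hv, hDv⟩ := hP S (Finset.card_pos.1 (by omega))
    obtain ⟨o, ho0, hoi, ho⟩ := ih (S.erase v) (by rw [Finset.card_erase_of_mem hv]; omega)
    refine ⟨fun w => if w = v then 0 else o w + 1, ?_, ?_, ?_⟩
    · intro w
      have := ho0 w
      dsimp only
      split_ifs <;> omega
    · intro a ha b hb hab
      have h1 := ho0 a
      have h2 := ho0 b
      dsimp only at hab
      split_ifs at hab with h3 h4 h4
      · rw [h3, h4]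
      · omega
      · omega
      · exact hoi (by simpa [h3] using ha) (by simpa [h4] using hb) (by omega)
    · intro u hu
      by_cases huv : u = v
      · subst huv
        refine hDv.trans (Finset.sum_le_sum fun w _ => ?_)
        by_cases h : w ∈ S
        · simp only [h, not_true_eq_false, if_false]
          split_ifs <;> positivity
        · simp [h]
      · refine (ho u (by simp [huv, hu])).trans (Finset.sum_le_sum fun w _ => ?_)
        have h0 := ho0 u
        by_cases hw : w = v
        · subst hw
          simp [huv, show (0 : ℤ) < o u + 1 by omega]
        · simp [huv, hw]

open Classical in
lemma dhar [Fintype V] (m : V → V → ℕ) (D : V → ℤ)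
    (hP : ∀ S : Finset V, S.Nonempty → ∃ v ∈ S, D v + 1 ≤ ∑ w, if w ∉ S then (m v w : ℤ) else 0) :
    ∃ o : V → ℤ, Function.Injective o ∧ ∀ v, D v ≤ nu m o v := by
  obtain ⟨o, -, h1, h2⟩ := dhar_aux m D hP _ Finset.univ rfl
  refine ⟨o, by simpa [Set.injOn_univ] using h1, fun v => ?_⟩
  have := h2 v (Finset.mem_univ v)
  simp only [Finset.mem_univ, not_true_eq_false, false_or] at this
  simp only [nu]
  omega

lemma exists_source [Fintype V] [DecidableEq V] (m : V → V → ℕ) (hm : IsGraph m) (q : V) :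
    ∃ o : V → ℤ, Function.Injective o ∧ ∀ v, (if v = q then -1 else 0) ≤ nu m o v := by
  classical
  apply dhar m (fun v => if v = q then -1 else 0)
  intro S hS
  by_cases hq : q ∈ S
  · refine ⟨q, hq, ?_⟩
    simp only [if_true]
    exact Finset.sum_nonneg fun w _ => by split_ifs <;> positivity
  · by_contra! hc
    obtain ⟨a, ha⟩ := hS
    apply hq
    refine conn_closed m hm (S : Set V) ?_ a ha q
    intro v hv w hw
    by_contra hwS
    have hvq : v ≠ q := by rintro rfl; exact hq hv
    have h1 := hc v hv
    have h2 := Finset.single_le_sum (f := fun w => if w ∉ S then (m v w : ℤ) else 0)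
      (fun w _ => by split_ifs <;> positivity) (Finset.mem_univ w)
    have hwS' : w ∉ S := hwS
    simp only [hvq, if_false, hwS', not_false_eq_true, if_true] at h1 h2
    refine absurd h1 (not_lt.2 ?_)
    exact le_trans (by omega) (h2.trans (le_of_eq (Finset.sum_congr rfl fun w _ => by congr)))

/-- total debt -/
def debt [Fintype V] (D : V → ℤ) : ℕ := ∑ v, (- D v).toNat

open Classical in
lemma lap_ind [Fintype V] (m : V → V → ℕ) (S : Finset V) (v : V) :
    laplacian m (fun v => if v ∈ S then 1 else 0) v =
      if v ∈ S then ∑ w, (if w ∉ S then (m v w : ℤ) else 0)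
      else - ∑ w, (if w ∈ S then (m v w : ℤ) else 0) := by
  rw [lap_eq]
  split_ifs with h
  · refine Finset.sum_congr rfl fun w _ => ?_
    by_cases hw : w ∈ S <;> simp [hw]
  · rw [← Finset.sum_neg_distrib]
    refine Finset.sum_congr rfl fun w _ => ?_
    by_cases hw : w ∈ S <;> simp [hw]

lemma debt_lower [Fintype V] (D : V → ℤ) (v : V) : - (debt D : ℤ) ≤ D v := by
  have h : (- D v).toNat ≤ debt D :=
    Finset.single_le_sum (f := fun v => (- D v).toNat) (fun _ _ => Nat.zero_le _) (Finset.mem_univ v)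
  omega

lemma unwin_le_nu [Fintype V] (m : V → V → ℕ) (hm : IsGraph m) (D0 : V → ℤ)
    (hD0 : ¬ Winnable m D0) :
    ∃ f : V → ℤ, ∃ o : V → ℤ, Function.Injective o ∧ ∀ v, (D0 - laplacian m f) v ≤ nu m o v := by
  classical
  -- choose a minimal debt representative
  obtain ⟨f0, hf0⟩ : ∃ f0 : V → ℤ, ∀ f, debt (D0 - laplacian m f0) ≤ debt (D0 - laplacian m f) := by
    exact ⟨_, fun f => Function.argmin_le (fun f : V → ℤ => debt (D0 - laplacian m f)) f⟩
  set D := D0 - laplacian m f0 with hD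
  have hmin : ∀ f, debt D ≤ debt (D - laplacian m f) := by
    intro f
    have := hf0 (f0 + f)
    rwa [lap_add, ← sub_sub] at this
  obtain ⟨x, hx⟩ : ∃ x, D x < 0 := by
    by_contra! hc
    exact hD0 ⟨D, hc, f0, by rw [hD]; abel⟩
  let F : Set (V → ℤ) := {f | f x = 0 ∧ debt (D - laplacian m f) ≤ debt D ∧ (D - laplacian m f) x < 0}
  have hFfin : F.Finite := by
    have hinj : Set.InjOn (fun f => D - laplacian m f) F := by
      intro f hf g hg hfg
      have h1 : laplacian m f = laplacian m g := sub_right_injective hfg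
      have h2 : laplacian m (f + -g) = 0 := by rw [lap_add, lap_neg, h1]; simp
      funext v
      have h3 := lap_ker m hm _ h2 v x
      have h4 := hf.1
      have h5 := hg.1
      simp only [Pi.add_apply, Pi.neg_apply] at h3
      omega
    refine Set.Finite.of_finite_image ?_ hinj
    refine (Set.finite_Icc (fun _ : V => - (debt D : ℤ))
      (fun _ : V => ∑ v, D v + Fintype.card V * debt D)).subset ?_
    rintro _ ⟨f, hf, rfl⟩
    have hlow : ∀ v, - (debt D : ℤ) ≤ (D - laplacian m f) v := by
      intro v
      have h1 := debt_lower (D - laplacian m f) v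
      have h2 := hf.2.1
      omega
    refine ⟨hlow, fun v => ?_⟩
    have h3 : ∑ v, ((D - laplacian m f) v + debt D) = ∑ v, D v + Fintype.card V * debt D := by
      simp only [Pi.sub_apply, Finset.sum_add_distrib, Finset.sum_sub_distrib, lap_sum m hm.1]
      simp
    have h4 := Finset.single_le_sum (f := fun v => (D - laplacian m f) v + debt D)
      (fun v _ => by have := hlow v; omega) (Finset.mem_univ v)
    rw [h3] at h4
    dsimp only at h4 ⊢
    omega
  have hzero : laplacian m 0 = 0 := by funext v; simp [lap_eq]
  have h0F : (0 : V → ℤ) ∈ F := by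
    refine ⟨rfl, ?_, ?_⟩ <;> rw [hzero, sub_zero]
    exact hx
  obtain ⟨f, hf, hfmax⟩ := Set.exists_max_image F (fun f => ∑ v, f v) hFfin ⟨0, h0F⟩
  refine ⟨f0 + f, ?_⟩
  rw [lap_add, ← sub_sub, ← hD]
  apply dhar
  intro S hS
  by_contra! hc
  have hnn : ∀ v ∈ S, 0 ≤ (D - laplacian m f) v := by
    intro v hv
    have h1 := hc v hv
    have h2 : (0 : ℤ) ≤ ∑ w, (if w ∉ S then (m v w : ℤ) else 0) :=
      Finset.sum_nonneg fun w _ => by split_ifs <;> positivity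
    omega
  have hxS : x ∉ S := fun h => by
    have := hnn x h
    have := hf.2.2
    omega
  let g : V → ℤ := fun v => if v ∈ S then 1 else 0
  have heq : ∀ v, (D - laplacian m (f + g)) v = (D - laplacian m f) v - laplacian m g v := by
    intro v; rw [lap_add]; simp only [Pi.sub_apply, Pi.add_apply]; ring
  have hpt : ∀ v ∈ Finset.univ, (-(D - laplacian m (f + g)) v).toNat ≤ (-(D - laplacian m f) v).toNat := by
    intro v _
    rw [heq, lap_ind]
    split_ifs with h
    · have := hc v h
      omega
    · have h2 : (0 : ℤ) ≤ ∑ w, (if w ∈ S then (m v w : ℤ) else 0) :=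
        Finset.sum_nonneg fun w _ => by split_ifs <;> positivity
      omega
  have hle : debt (D - laplacian m (f + g)) ≤ debt (D - laplacian m f) := Finset.sum_le_sum hpt
  have hdeq : debt (D - laplacian m (f + g)) = debt (D - laplacian m f) := by
    have := hmin (f + g)
    have := hf.2.1
    omega
  have hxeq := (Finset.sum_eq_sum_iff_of_le hpt).1 hdeq x (Finset.mem_univ x)
  have hmem : f + g ∈ F := by
    refine ⟨?_, hle.trans hf.2.1, ?_⟩
    · simp [g, hxS, hf.1]
    · have := hf.2.2
      omega
  have h1 := hfmax _ hmem
  have h2 : (0 : ℤ) < ∑ v, g v := by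
    simp only [g, Finset.sum_boole, Finset.filter_mem_eq_inter, Finset.univ_inter]
    exact_mod_cast Finset.card_pos.2 hS
  simp only [Pi.add_apply, Finset.sum_add_distrib] at h1
  omega

theorem rank_canonical [Fintype V] (m : V → V → ℕ) (hm : IsGraph m) :
    rankDiv m (canonical m) = genus m - 1 := by
  classical
  haveI : Nonempty V := hm.2.2.nonempty
  obtain ⟨q⟩ := ‹Nonempty V›
  haveI : Nonempty V := ⟨q⟩
  obtain ⟨o, ho, hoq⟩ := exists_source m hm q
  have hsum := nu_sum m hm o ho
  have hg : 0 ≤ genus m := by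
    have h1 : ∑ v, (if v = q then (-1 : ℤ) else 0) ≤ ∑ v, nu m o v :=
      Finset.sum_le_sum fun v _ => hoq v
    simp at h1
    omega
  unfold rankDiv
  apply IsGreatest.csSup_eq
  constructor
  · rcases hg.eq_or_lt with h | h
    · left; omega
    · right
      refine ⟨by omega, fun E hE hdE => ?_⟩
      by_contra hw
      obtain ⟨f, p, hp, hle⟩ := unwin_le_nu m hm _ hw
      have hK : ∑ v, canonical m v = 2 * (genus m - 1) := by
        rw [← Finset.sum_congr rfl fun v _ => nu_add m hm o ho v, Finset.sum_add_distrib, hsum,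
          nu_sum m hm _ (fun a b hab => ho (neg_injective hab))]
        ring
      have heq : ∑ v, (canonical m - E - laplacian m f) v = ∑ v, nu m p v := by
        rw [nu_sum m hm p hp]
        simp only [Pi.sub_apply, Finset.sum_sub_distrib, lap_sum m hm.1, hK]
        unfold divDeg at hdE
        omega
      have hpt := (Finset.sum_eq_sum_iff_of_le fun v _ => hle v).1 heq
      refine nu_not_win m (fun x => - p x) _ (fun _ => le_rfl) ⟨E, hE, f, ?_⟩
      funext v
      have h1 := hpt v (Finset.mem_univ v)
      have h2 := nu_add m hm p hp v
      simp only [Pi.sub_apply] at h1 ⊢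
      omega
  · rintro s (rfl | ⟨hs, h⟩)
    · omega
    · by_contra! hlt
      refine nu_not_win m (fun x => - o x) _ ?_
        (h (fun v => nu m o v + if v = q then s - genus m + 1 else 0) ?_ ?_)
      · intro v
        have := nu_add m hm o ho v
        simp only [Pi.sub_apply]
        split_ifs <;> omega
      · intro v
        have := hoq v
        dsimp only
        split_ifs at this ⊢ <;> omega
      · simp only [divDeg, Finset.sum_add_distrib, hsum]
        simp
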